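/- For all integers n ≥ 1 and a ≥ 0, one has ∫₀¹ x^{2n−1} · (2·arccos(x))^{2a+1} / (2a+1)! dx = ( C(2n,n) · π / (2^{2n+1} · n) ) · Σ_{n < m₁ < m₂ < ⋯ < m_a} 1/(m₁² m₂² ⋯ m_a²), where the sum over strictly increasing a-tuples of integers greater than n is interpreted as 1 when a = 0, and the sum converges. -/

import Mathlib

open Real MeasureTheory

/-- The divided power `(2t)^k / k!`. -/
noncomputable def dividedPow (k : ℕ) (t : ℝ) : ℝ := (2 * t) ^ k / (Nat.factorial k : ℝ)

lemma hasDerivAt_dividedPow_succ (k : ℕ) (t : ℝ) :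
    HasDerivAt (dividedPow (k + 1)) (2 * dividedPow k t) t := by
  have h := (((hasDerivAt_id t).const_mul 2).pow (k + 1)).div_const
    (Nat.factorial (k + 1) : ℝ)
  refine h.congr_deriv ?_
  have : (Nat.factorial k : ℝ) ≠ 0 := by positivity
  simp only [dividedPow, Nat.factorial_succ, id]
  push_cast
  field_simp

@[fun_prop]
lemma continuous_dividedPow (k : ℕ) : Continuous (dividedPow k) := by
  unfold dividedPow
  fun_prop

lemma dividedPow_succ_zero (k : ℕ) : dividedPow (k + 1) 0 = 0 := by
  simp [dividedPow]

/-- The moment `∫₀^{π/2} cos^{2n} t · (2t)^{2a} / (2a)! dt`. -/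
noncomputable def cosMoment (n a : ℕ) : ℝ :=
  ∫ t in (0 : ℝ)..(π / 2), cos t ^ (2 * n) * dividedPow (2 * a) t

lemma hasDerivAt_cos_pow (k : ℕ) (t : ℝ) :
    HasDerivAt (fun t => cos t ^ (k + 1)) (-((k + 1) * cos t ^ k * sin t)) t := by
  refine ((hasDerivAt_cos t).pow (k + 1)).congr_deriv ?_
  simp

lemma integral_cos_pow_mul_sin_mul_dividedPow (n a : ℕ) :
    ∫ t in (0 : ℝ)..(π / 2), cos t ^ (2 * n + 1) * sin t * dividedPow (2 * a + 1) t =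
      cosMoment (n + 1) a / (n + 1) := by
  have h : ∫ t in (0 : ℝ)..(π / 2),
      (2 * (cos t ^ (2 * (n + 1)) * dividedPow (2 * a) t) -
        2 * (n + 1) * (cos t ^ (2 * n + 1) * sin t * dividedPow (2 * a + 1) t)) = 0 := by
    rw [intervalIntegral.integral_eq_sub_of_hasDerivAt
      (f := fun t => cos t ^ (2 * n + 1 + 1) * dividedPow (2 * a + 1) t)]
    · simp [dividedPow_succ_zero]
    · intro t _
      refine ((hasDerivAt_cos_pow (2 * n + 1) t).mul
        (hasDerivAt_dividedPow_succ (2 * a) t)).congr_deriv ?_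
      push_cast
      ring
    · exact Continuous.intervalIntegrable (by fun_prop) _ _
  rw [intervalIntegral.integral_sub (Continuous.intervalIntegrable (by fun_prop) _ _)
    (Continuous.intervalIntegrable (by fun_prop) _ _),
    intervalIntegral.integral_const_mul, intervalIntegral.integral_const_mul] at h
  rw [eq_div_iff (by positivity), cosMoment]
  linarith

lemma cosMoment_recurrence (n a : ℕ) :
    (2 * n + 2) * (2 * n + 1) * cosMoment n (a + 1) =
      4 * (n + 1) ^ 2 * cosMoment (n + 1) (a + 1) + 4 * cosMoment (n + 1) a := by
  have h : ∫ t in (0 : ℝ)..(π / 2),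
      ((2 * n + 2) * (2 * n + 1) * (cos t ^ (2 * n) * dividedPow (2 * (a + 1)) t) -
        4 * (n + 1) ^ 2 * (cos t ^ (2 * (n + 1)) * dividedPow (2 * (a + 1)) t) -
        4 * (cos t ^ (2 * (n + 1)) * dividedPow (2 * a) t)) = 0 := by
    rw [intervalIntegral.integral_eq_sub_of_hasDerivAt
      (f := fun t => -(2 * n + 2) * (cos t ^ (2 * n + 1) * sin t * dividedPow (2 * a + 1 + 1) t)
        - 2 * (cos t ^ (2 * n + 1 + 1) * dividedPow (2 * a + 1) t))]
    · simp [dividedPow_succ_zero]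
    · intro t _
      refine (((((hasDerivAt_cos_pow (2 * n) t).mul (hasDerivAt_sin t)).mul
        (hasDerivAt_dividedPow_succ (2 * a + 1) t)).const_mul (-(2 * n + 2 : ℝ))).sub
        (((hasDerivAt_cos_pow (2 * n + 1) t).mul
          (hasDerivAt_dividedPow_succ (2 * a) t)).const_mul 2)).congr_deriv ?_
      have hs : sin t ^ 2 = 1 - cos t ^ 2 := sin_sq t
      push_cast
      simp only [Pi.mul_apply, show 2 * (a + 1) = 2 * a + 1 + 1 by ring]
      linear_combination (2 * n + 2) * (2 * n + 1) * cos t ^ (2 * n) *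
        dividedPow (2 * a + 1 + 1) t * hs
    · exact Continuous.intervalIntegrable (by fun_prop) _ _
  rw [intervalIntegral.integral_sub (Continuous.intervalIntegrable (by fun_prop) _ _)
    (Continuous.intervalIntegrable (by fun_prop) _ _),
    intervalIntegral.integral_sub (Continuous.intervalIntegrable (by fun_prop) _ _)
    (Continuous.intervalIntegrable (by fun_prop) _ _),
    intervalIntegral.integral_const_mul, intervalIntegral.integral_const_mul,
    intervalIntegral.integral_const_mul] at h
  simp only [cosMoment]
  linarith

lemma cosMoment_succ_zero (n : ℕ) :
    (2 * n + 2) * cosMoment (n + 1) 0 = (2 * n + 1) * cosMoment n 0 := by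
  simp only [cosMoment, dividedPow, mul_zero, pow_zero, Nat.factorial_zero, Nat.cast_one,
    div_one, mul_one]
  rw [show 2 * (n + 1) = 2 * n + 2 by ring, integral_cos_pow]
  simp
  field_simp

lemma cosMoment_zero_right (n : ℕ) :
    cosMoment n 0 = ((2 * n).choose n : ℝ) * π / 2 ^ (2 * n + 1) := by
  rw [← Nat.centralBinom_eq_two_mul_choose]
  induction n with
  | zero => simp [cosMoment, dividedPow]
  | succ n ih =>
    have h := cosMoment_succ_zero n
    have hc : ((n : ℝ) + 1) * (n + 1).centralBinom = 2 * (2 * n + 1) * n.centralBinom := by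
      exact_mod_cast Nat.succ_mul_centralBinom_succ n
    rw [ih] at h
    have hn : (2 * (n : ℝ) + 2) ≠ 0 := by positivity
    apply mul_left_cancel₀ hn
    rw [h, show 2 * (n + 1) + 1 = 2 * n + 1 + 2 by ring, pow_add]
    field_simp
    linear_combination (-4 * 2 ^ (2 * n) : ℝ) * hc

lemma cosMoment_zero_right_pos (n : ℕ) : 0 < cosMoment n 0 := by
  rw [cosMoment_zero_right]
  have : 0 < (2 * n).choose n := Nat.choose_pos (by omega)
  positivity

lemma cosMoment_nonneg (n a : ℕ) : 0 ≤ cosMoment n a := by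
  refine intervalIntegral.integral_nonneg (by positivity) fun t ht => ?_
  have := ht.1
  unfold dividedPow
  rw [pow_mul]
  positivity

/-- The moment `cosMoment n a`, normalized by its value at `a = 0`. -/
noncomputable def normalizedMoment (n a : ℕ) : ℝ := cosMoment n a / cosMoment n 0

lemma normalizedMoment_nonneg (n a : ℕ) : 0 ≤ normalizedMoment n a :=
  div_nonneg (cosMoment_nonneg n a) (cosMoment_nonneg n 0)

lemma normalizedMoment_sub_succ (n a : ℕ) :
    normalizedMoment n (a + 1) - normalizedMoment (n + 1) (a + 1) =
      1 / ((n + 1 : ℕ) : ℝ) ^ 2 * normalizedMoment (n + 1) a := by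
  have h := cosMoment_recurrence n a
  have h0 := cosMoment_succ_zero n
  have hp := (cosMoment_zero_right_pos (n + 1)).ne'
  have hn : (2 * (n : ℝ) + 1) ≠ 0 := by positivity
  have hc : cosMoment n 0 = (2 * n + 2) * cosMoment (n + 1) 0 / (2 * n + 1) := by
    rw [h0]; field_simp
  have hm : (2 * (n : ℝ) + 2) ≠ 0 := by positivity
  simp only [normalizedMoment, hc]
  push_cast
  have hm' : (n : ℝ) + 1 ≠ 0 := by positivity
  field_simp
  linear_combination h / 2

lemma dividedPow_le_sin_sq (a : ℕ) {t : ℝ} (ht : t ∈ Set.Icc 0 (π / 2)) :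
    dividedPow (2 * (a + 1)) t ≤ π ^ (2 * (a + 1)) * sin t ^ 2 := by
  have hs : 2 / π * t ≤ sin t := mul_le_sin ht.1 ht.2
  have ht0 := ht.1
  have h2 : 2 * t ≤ π * sin t := by
    calc 2 * t = π * (2 / π * t) := by field_simp
      _ ≤ π * sin t := by gcongr
  have hs0 : 0 ≤ sin t := le_trans (by positivity) hs
  calc dividedPow (2 * (a + 1)) t ≤ (2 * t) ^ (2 * (a + 1)) :=
        div_le_self (by positivity) (by exact_mod_cast Nat.factorial_pos _)
    _ ≤ (π * sin t) ^ (2 * (a + 1)) := by gcongr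
    _ = π ^ (2 * (a + 1)) * sin t ^ (2 * (a + 1)) := mul_pow _ _ _
    _ ≤ π ^ (2 * (a + 1)) * sin t ^ 2 := by
        gcongr ?_ * ?_
        exact pow_le_pow_of_le_one hs0 (sin_le_one t) (by omega)

lemma normalizedMoment_succ_le (n a : ℕ) :
    normalizedMoment n (a + 1) ≤ π ^ (2 * (a + 1)) * (1 / (n + 1 : ℝ)) := by
  have hp := cosMoment_zero_right_pos n
  have hle : cosMoment n (a + 1) ≤
      π ^ (2 * (a + 1)) * (cosMoment n 0 - cosMoment (n + 1) 0) := by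
    simp only [cosMoment]
    rw [← intervalIntegral.integral_sub (Continuous.intervalIntegrable (by fun_prop) _ _)
      (Continuous.intervalIntegrable (by fun_prop) _ _), ← intervalIntegral.integral_const_mul]
    refine intervalIntegral.integral_mono_on (by positivity)
      (Continuous.intervalIntegrable (by fun_prop) _ _)
      (Continuous.intervalIntegrable (by fun_prop) _ _) fun t ht => ?_
    have hc : 0 ≤ cos t ^ (2 * n) := by rw [pow_mul]; positivity
    refine (mul_le_mul_of_nonneg_left (dividedPow_le_sin_sq a ht) hc).trans_eq ?_
    rw [sin_sq]
    simp only [dividedPow, mul_zero, pow_zero, Nat.factorial_zero, Nat.cast_one, div_one, mul_one]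
    ring
  have hd : (cosMoment n 0 - cosMoment (n + 1) 0) ≤ 1 / (n + 1 : ℝ) * cosMoment n 0 := by
    have h0 := cosMoment_succ_zero n
    rw [div_mul_eq_mul_div, le_div_iff₀ (by positivity)]
    nlinarith
  rw [normalizedMoment, div_le_iff₀ hp, mul_assoc]
  exact hle.trans (by gcongr)

lemma tendsto_normalizedMoment_succ (a : ℕ) :
    Filter.Tendsto (fun n => normalizedMoment n (a + 1)) Filter.atTop (nhds 0) := by
  refine squeeze_zero (fun n => normalizedMoment_nonneg n _)
    (fun n => normalizedMoment_succ_le n a) ?_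
  simpa using (tendsto_one_div_add_atTop_nhds_zero_nat (𝕜 := ℝ)).const_mul (π ^ (2 * (a + 1)))

lemma hasSum_normalizedMoment (n a : ℕ) :
    HasSum (fun k : ℕ => 1 / ((n + k + 1 : ℕ) : ℝ) ^ 2 * normalizedMoment (n + k + 1) a)
      (normalizedMoment n (a + 1)) := by
  rw [hasSum_iff_tendsto_nat_of_nonneg fun k =>
    mul_nonneg (by positivity) (normalizedMoment_nonneg _ _)]
  have h : ∀ N, ∑ k ∈ Finset.range N,
      1 / ((n + k + 1 : ℕ) : ℝ) ^ 2 * normalizedMoment (n + k + 1) a =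
      normalizedMoment n (a + 1) - normalizedMoment (N + n) (a + 1) := fun N => by
    simp only [← normalizedMoment_sub_succ]
    rw [add_comm N n]
    exact Finset.sum_range_sub' (fun k => normalizedMoment (n + k) (a + 1)) N
  simp only [h]
  simpa using ((Filter.tendsto_add_atTop_iff_nat n).2
    (tendsto_normalizedMoment_succ a)).const_sub (normalizedMoment n (a + 1))

/-- Strictly increasing `a`-tuples of natural numbers greater than `n`. -/
abbrev IncreasingTuple (n a : ℕ) : Type :=
  {m : Fin a → ℕ // StrictMono m ∧ ∀ i, n < m i}

/-- Splitting off the first entry of an increasing tuple. -/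
def increasingTupleSuccEquiv (n a : ℕ) :
    (Σ k : ℕ, IncreasingTuple (n + k + 1) a) ≃ IncreasingTuple n (a + 1) where
  toFun p := ⟨Fin.cons (n + p.1 + 1) p.2.1, by
    refine ⟨?_, ?_⟩
    · intro i j hij
      induction j using Fin.cases with
      | zero => simp at hij
      | succ j =>
        induction i using Fin.cases with
        | zero => simpa using p.2.2.2 j
        | succ i => simpa using p.2.2.1 (Fin.succ_lt_succ_iff.1 hij)
    · intro i
      induction i using Fin.cases with
      | zero => simp only [Fin.cons_zero]; omega
      | succ i => have := p.2.2.2 i; simp only [Fin.cons_succ]; omega⟩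
  invFun m := ⟨m.1 0 - n - 1, Fin.tail m.1, by
    have h0 := m.2.2 0
    refine ⟨fun i j hij => m.2.1 (Fin.succ_lt_succ_iff.2 hij), fun i => ?_⟩
    have := m.2.1 (Fin.succ_pos i)
    simp only [Fin.tail]
    omega⟩
  left_inv p := by
    obtain ⟨k, m, hm⟩ := p
    have hk : n + k + 1 - n - 1 = k := by omega
    simp only [Fin.tail_cons]
    congr!
  right_inv m := by
    have h0 := m.2.2 0
    apply Subtype.ext
    simp only
    rw [show n + (m.1 0 - n - 1) + 1 = m.1 0 by omega]
    exact Fin.cons_self_tail m.1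

lemma hasSum_increasingTuple (n a : ℕ) :
    HasSum (fun m : IncreasingTuple n a => ∏ i : Fin a, (1 : ℝ) / ((m.1 i : ℝ) ^ 2))
      (normalizedMoment n a) := by
  induction a generalizing n with
  | zero =>
    have h1 : normalizedMoment n 0 = 1 := div_self (cosMoment_zero_right_pos n).ne'
    let m₀ : IncreasingTuple n 0 := ⟨Fin.elim0, fun i => i.elim0, fun i => i.elim0⟩
    have : Unique (IncreasingTuple n 0) := ⟨⟨m₀⟩, fun m => Subtype.ext (Subsingleton.elim _ _)⟩
    rw [h1]
    simpa only [Finset.univ_eq_empty, Finset.prod_empty] using hasSum_unique (fun m : IncreasingTuple n 0 =>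
      ∏ i : Fin 0, (1 : ℝ) / ((m.1 i : ℝ) ^ 2))
  | succ a ih =>
    rw [← (increasingTupleSuccEquiv n a).hasSum_iff]
    have hprod : ((fun m : IncreasingTuple n (a + 1) =>
        ∏ i : Fin (a + 1), (1 : ℝ) / ((m.1 i : ℝ) ^ 2)) ∘ increasingTupleSuccEquiv n a) =
        fun p => 1 / ((n + p.1 + 1 : ℕ) : ℝ) ^ 2 *
          ∏ i : Fin a, (1 : ℝ) / ((p.2.1 i : ℝ) ^ 2) := by
      funext p
      simp only [Function.comp_apply, Fin.prod_univ_succ]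
      rfl
    rw [hprod]
    have hfib : ∀ k : ℕ, HasSum (fun m : IncreasingTuple (n + k + 1) a =>
        1 / ((n + k + 1 : ℕ) : ℝ) ^ 2 * ∏ i : Fin a, (1 : ℝ) / ((m.1 i : ℝ) ^ 2))
        (1 / ((n + k + 1 : ℕ) : ℝ) ^ 2 * normalizedMoment (n + k + 1) a) :=
      fun k => (ih (n + k + 1)).mul_left _
    refine HasSum.sigma_of_hasSum (hasSum_normalizedMoment n a) hfib ?_
    refine (summable_sigma_of_nonneg fun p => by positivity).2
      ⟨fun k => (hfib k).summable, ?_⟩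
    simpa only [(hfib _).tsum_eq] using (hasSum_normalizedMoment n a).summable

lemma integral_pow_mul_dividedPow_arccos (n a : ℕ) :
    ∫ x in (0 : ℝ)..1, x ^ (2 * n + 1) * dividedPow (2 * a + 1) (arccos x) =
      cosMoment (n + 1) a / (n + 1) := by
  have h := intervalIntegral.integral_comp_mul_deriv (a := π / 2) (b := 0) (f := cos)
    (f' := fun t => -sin t)
    (g := fun x => x ^ (2 * n + 1) * dividedPow (2 * a + 1) (arccos x))
    (fun t _ => hasDerivAt_cos t) (by fun_prop)
    ((continuous_id.pow _).mul ((continuous_dividedPow _).comp continuous_arccos))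
  rw [cos_pi_div_two, cos_zero] at h
  rw [← h, intervalIntegral.integral_symm, ← intervalIntegral.integral_neg,
    ← integral_cos_pow_mul_sin_mul_dividedPow]
  refine intervalIntegral.integral_congr fun t ht => ?_
  rw [Set.uIcc_of_le (by positivity)] at ht
  simp only [Function.comp_apply]
  rw [arccos_cos ht.1 (by linarith [ht.2, pi_pos])]
  ring

/-- For all `n ≥ 1` and `a ≥ 0`, the integral
`∫₀¹ x^{2n−1} (2 arccos x)^{2a+1}/(2a+1)! dx` converges, the sum
`Σ_{n<m₁<⋯<m_a} 1/(m₁²⋯m_a²)` (interpreted as `1` when `a = 0`) converges, and the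
integral equals `C(2n,n)·π/(2^{2n+1}·n)` times the sum. -/
theorem integral_arccos_pow (n : ℕ) (hn : 1 ≤ n) (a : ℕ) :
    IntervalIntegrable
      (fun x : ℝ => x ^ (2 * n - 1) * (2 * Real.arccos x) ^ (2 * a + 1)
        / (Nat.factorial (2 * a + 1) : ℝ)) volume 0 1 ∧
    Summable (fun m : {m : Fin a → ℕ // StrictMono m ∧ ∀ i, n < m i} =>
      ∏ i : Fin a, (1 : ℝ) / ((m.1 i : ℝ) ^ 2)) ∧
    ∫ x in (0 : ℝ)..1, x ^ (2 * n - 1) * (2 * Real.arccos x) ^ (2 * a + 1)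
        / (Nat.factorial (2 * a + 1) : ℝ) =
      ((2 * n).choose n : ℝ) * π / (2 ^ (2 * n + 1) * (n : ℝ))
        * ∑' m : {m : Fin a → ℕ // StrictMono m ∧ ∀ i, n < m i},
            ∏ i : Fin a, (1 : ℝ) / ((m.1 i : ℝ) ^ 2) := by
  have hS := hasSum_increasingTuple n a
  refine ⟨Continuous.intervalIntegrable ?_ _ _, hS.summable, ?_⟩
  · exact ((continuous_id.pow _).mul ((continuous_const.mul continuous_arccos).pow _)).div_const _
  · rw [hS.tsum_eq, normalizedMoment]
    obtain ⟨k, rfl⟩ : ∃ k, n = k + 1 := ⟨n - 1, by omega⟩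
    have h := integral_pow_mul_dividedPow_arccos k a
    have hp := cosMoment_zero_right (k + 1)
    have hp0 := (cosMoment_zero_right_pos (k + 1)).ne'
    simp only [dividedPow, ← mul_div_assoc] at h
    rw [show 2 * (k + 1) - 1 = 2 * k + 1 by omega, h, ← div_div, ← hp]
    push_cast
    field_simp
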